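/- arXiv:1006.5265 — 3 statements merged into one kernel-verified Lean document; each statement's English description precedes it below -/
import Mathlib

section
/- Let n ≥ 1, let A be an n×n complex matrix, B an n×1 complex matrix, and G an n×n Hermitian complex matrix. Set s = (Bᴴ G B)₀₀ + 1 (a real scalar since G is Hermitian) and assume s ≠ 0, and define the 1×n matrix C = s⁻¹ · (Bᴴ G A). Then Aᴴ G A − s⁻¹ · (Aᴴ G B)(Bᴴ G A) = (A − B C)ᴴ G (A − B C) + Cᴴ C. In particular, G satisfies the discrete algebraic Riccati equation G = Aᴴ G A − Aᴴ G B (Bᴴ G B + 1)⁻¹ Bᴴ G A if and only if it satisfies the discrete algebraic Lyapunov equation G = (A − B C)ᴴ G (A − B C) + Cᴴ C. -/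
open Matrix

/-- The DARE-to-DALE identity with gain matrix
`C = (Bᴴ G B + 1)⁻¹ Bᴴ G A`. -/
theorem dare_iff_dale (n : ℕ) (hn : 1 ≤ n)
    (A G : Matrix (Fin n) (Fin n) ℂ) (B : Matrix (Fin n) (Fin 1) ℂ)
    (hG : G.IsHermitian)
    (s : ℂ) (hs : s = (Bᴴ * G * B) 0 0 + 1) (hs0 : s ≠ 0)
    (C : Matrix (Fin 1) (Fin n) ℂ) (hC : C = s⁻¹ • (Bᴴ * G * A)) :
    Aᴴ * G * A - s⁻¹ • (Aᴴ * G * B * (Bᴴ * G * A))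
      = (A - B * C)ᴴ * G * (A - B * C) + Cᴴ * C ∧
    (G = Aᴴ * G * A - s⁻¹ • (Aᴴ * G * B * (Bᴴ * G * A))
      ↔ G = (A - B * C)ᴴ * G * (A - B * C) + Cᴴ * C) := by
  have hG_eq : Gᴴ = G := hG
  have hB : Bᴴ * G * B = (s - 1) • (1 : Matrix (Fin 1) (Fin 1) ℂ) := by
    ext i j
    fin_cases i; fin_cases j
    simp [hs]
  have hs_star : star s = s := by
    have h : (Bᴴ * G * B).IsHermitian := isHermitian_conjTranspose_mul_mul B hG
    rw [hs, star_add, star_one, h.apply 0 0]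
  have hK : Bᴴ * G * A = s • C := by rw [hC, smul_inv_smul₀ hs0]
  have hK_star : Aᴴ * G * B = s • Cᴴ := by
    rw [← hs_star, ← conjTranspose_smul, ← hK]
    simp [hG_eq, Matrix.mul_assoc]
  have hquad : (A - B * C)ᴴ * G * (A - B * C)
      = Aᴴ * G * A - Aᴴ * G * B * C - Cᴴ * (Bᴴ * G * A) + Cᴴ * (Bᴴ * G * B) * C := by
    simp only [conjTranspose_sub, conjTranspose_mul, Matrix.sub_mul, Matrix.mul_sub,
      Matrix.mul_assoc]
    abel
  have key : Aᴴ * G * A - s⁻¹ • (Aᴴ * G * B * (Bᴴ * G * A))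
      = (A - B * C)ᴴ * G * (A - B * C) + Cᴴ * C := by
    rw [hquad, hB, hK_star, hK]
    simp only [Matrix.smul_mul, Matrix.mul_smul, Matrix.mul_one, inv_smul_smul₀ hs0]
    module
  exact ⟨key, by rw [key]⟩
end

section
/- Let N ≥ 1 be an integer and β > 1 a real number. Set λ = (β^{2N} − 1)/N and g = (λ/N)·(1 − β^{−2N})/(1 − β^{−2}). Then 1 + λ·(N − λ/g) = β^{2(N−1)}. -/
/-- with `λ = (β^{2N} − 1)/N` and `g = (λ/N)(1 − β^{−2N})/(1 − β^{−2})`,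
we have `1 + λ(N − λ/g) = β^{2(N−1)}`. -/
theorem dare_diagonal_identity (N : ℕ) (hN : 1 ≤ N) (β : ℝ) (hβ : 1 < β)
    (lam g : ℝ)
    (hlam : lam = (β ^ (2 * N) - 1) / N)
    (hg : g = (lam / N) * (1 - (β ^ (2 * N))⁻¹) / (1 - (β ^ 2)⁻¹)) :
    1 + lam * (N - lam / g) = β ^ (2 * (N - 1)) := by
  have hn : (N : ℝ) ≠ 0 := by positivity
  have hB : 1 < β ^ (2 * N) := one_lt_pow₀ hβ (by omega)
  have hb : 1 < β ^ 2 := one_lt_pow₀ hβ two_ne_zero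
  have hBb : β ^ (2 * N) = β ^ 2 * β ^ (2 * (N - 1)) := by
    rw [← pow_add]
    congr 1
    omega
  generalize β ^ (2 * N) = B at *
  generalize β ^ 2 = b at *
  generalize β ^ (2 * (N - 1)) = c at *
  have hB0 : B ≠ 0 := by linarith
  have hb0 : b ≠ 0 := by linarith
  have hB1 : B - 1 ≠ 0 := by linarith
  have hb1 : b - 1 ≠ 0 := by linarith
  have hlam0 : lam ≠ 0 := by rw [hlam]; exact div_ne_zero hB1 hn
  have hquot : lam / g = N * (B * (b - 1)) / (b * (B - 1)) := by
    have hg' : g = lam * (b * (B - 1)) / (N * (B * (b - 1))) := by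
      rw [hg, show 1 - B⁻¹ = (B - 1) / B by field_simp,
        show 1 - b⁻¹ = (b - 1) / b by field_simp]
      field_simp
    rw [hg']
    field_simp
  rw [hquot, hlam]
  field_simp
  rw [hBb]
  ring
end

section
/- Let N ≥ 1 be an integer and β > 1 a real number. Set λ = (β^{2N} − 1)/N and g = (λ/N)·(1 − β^{−2N})/(1 − β^{−2}). Then (1 + N·λ)^{N−1} = (1 + λ·(N − λ/g))^{N}, both sides being equal to β^{2N(N−1)}. -/
/-- with `λ = (β^{2N} − 1)/N` and `g = (λ/N)(1 − β^{−2N})/(1 − β^{−2})`,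
we have `(1 + Nλ)^{N−1} = (1 + λ(N − λ/g))^{N}`, both sides equal to `β^{2N(N−1)}`. -/
theorem kramer_polynomial_identity (N : ℕ) (hN : 1 ≤ N) (β : ℝ) (hβ : 1 < β)
    (lam g : ℝ)
    (hlam : lam = (β ^ (2 * N) - 1) / N)
    (hg : g = (lam / N) * (1 - (β ^ (2 * N))⁻¹) / (1 - (β ^ 2)⁻¹)) :
    (1 + N * lam) ^ (N - 1) = (1 + lam * (N - lam / g)) ^ N ∧
    (1 + N * lam) ^ (N - 1) = β ^ (2 * N * (N - 1)) := by
  have hN0 : (N : ℝ) ≠ 0 := by positivity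
  have hb : β ^ 2 - 1 ≠ 0 := (sub_pos.2 (one_lt_pow₀ hβ two_ne_zero)).ne'
  have hB : β ^ (2 * N) - 1 ≠ 0 := (sub_pos.2 (one_lt_pow₀ hβ (by omega))).ne'
  have hβ0 : β ≠ 0 := by positivity
  have hsplit : β ^ (2 * N) = β ^ (2 * (N - 1)) * β ^ 2 := by
    rw [← pow_add]
    congr 1
    omega
  have hleft : 1 + N * lam = β ^ (2 * N) := by
    rw [hlam]
    field_simp
    ring
  have hquot : lam * (lam / g) = β ^ (2 * N) * (1 - (β ^ 2)⁻¹) := by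
    have hB0 : β ^ (2 * N) ≠ 0 := pow_ne_zero _ hβ0
    rw [hg, hlam]
    generalize β ^ (2 * N) = B at hB hB0 ⊢
    field_simp
  have hright : 1 + lam * (N - lam / g) = β ^ (2 * (N - 1)) := by
    calc
      1 + lam * (N - lam / g) = (1 + N * lam) - lam * (lam / g) := by ring
      _ = β ^ (2 * (N - 1)) := by
        rw [hleft, hquot, hsplit]
        field_simp
        ring
  rw [hleft, hright, ← pow_mul, ← pow_mul]
  exact ⟨by congr 1; ring, rfl⟩
end
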